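/- Let ω = (1,2,...,n,-1,-2,...,-n) ∈ W_n, let τ ∈ [ε, ω] with τ ≠ ε, and let τ = τ₁ ⋯ τ_k be the cycle factorization of type B of τ. Then: (i) if σ₁ ∈ [ε, τ₁], ..., σ_k ∈ [ε, τ_k], then σ₁, ..., σ_k commute with each other and σ := σ₁ ⋯ σ_k belongs to [ε, τ]; and (ii) every σ ∈ [ε, τ] can be written uniquely in the form σ = σ₁ ⋯ σ_k with σ_j ∈ [ε, τ_j] for each j. Hence [ε, τ] is canonically poset-isomorphic to the product [ε, τ₁] × ⋯ × [ε, τ_k]. -/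

import Mathlib

open scoped Classical

namespace NCPB

/-- A collection of subsets of `α` is a partition: blocks are nonempty and
every element lies in exactly one block. -/
def IsPartition {α : Type*} (P : Set (Set α)) : Prop :=
  (∀ B ∈ P, B.Nonempty) ∧ ∀ a : α, ∃! B, B ∈ P ∧ a ∈ B

/-- The non-crossing condition for a collection of subsets of a linear order:
if `a < b < c < d`, `a, c` lie in a block `B` and `b, d` lie in a block `C`,
then `b ∈ B` (i.e. the blocks coincide). -/
def IsNC {α : Type*} [LinearOrder α] (P : Set (Set α)) : Prop :=
  ∀ B ∈ P, ∀ C ∈ P, ∀ a b c d : α, a < b → b < c → c < d →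
    a ∈ B → c ∈ B → b ∈ C → d ∈ C → b ∈ B

/-- A non-crossing partition of a linear order. -/
def NCPart {α : Type*} [LinearOrder α] (P : Set (Set α)) : Prop :=
  IsPartition P ∧ IsNC P

/-- The set `[±m] = {1 < 2 < ... < m < -1 < -2 < ... < -m}` is encoded as `Fin (2*m)`,
position `k < m` encoding `k+1` and position `m + j` encoding `-(j+1)`.
`negMap` is the inversion map `a ↦ -a`. -/
def negMap (m : ℕ) (k : Fin (2*m)) : Fin (2*m) :=
  ⟨(k.val + m) % (2*m), Nat.mod_lt _ (Nat.lt_of_le_of_lt (Nat.zero_le _) k.isLt)⟩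

/-- Image of a subset of `[±m]` under the inversion map, i.e. `X ↦ -X`. -/
def negSet (m : ℕ) (X : Set (Fin (2*m))) : Set (Fin (2*m)) := negMap m '' X

/-- The absolute value map `[±m] → {1,...,m}`, `±i ↦ i`. -/
def absMap (m : ℕ) (k : Fin (2*m)) : Fin m :=
  ⟨k.val % m, Nat.mod_lt _ (by have := k.isLt; omega)⟩

/-- A non-crossing partition of type B: a non-crossing partition of `[±m]`
invariant under the inversion map. -/
def NCBPart (m : ℕ) (π : Set (Set (Fin (2*m)))) : Prop :=
  NCPart π ∧ ∀ B ∈ π, negSet m B ∈ π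

/-- The collection of sets `Abs(X)`, `X` a block of `π`. -/
def absPart (m : ℕ) (π : Set (Set (Fin (2*m)))) : Set (Set (Fin m)) :=
  {F | ∃ X ∈ π, F = absMap m '' X}

/-- The embedding of `{1,...,m}` onto the odd-indexed positions of the interleaved
set `1 < 1̄ < 2 < 2̄ < ... < m < m̄` (encoded as `Fin (2*m)`): `i ↦ i` (even positions). -/
def evens (m : ℕ) (i : Fin m) : Fin (2*m) := ⟨2*i.val, by have := i.isLt; omega⟩

/-- The embedding of the barred copy `{1̄,...,m̄}` into the interleaved set: odd positions. -/
def odds (m : ℕ) (i : Fin m) : Fin (2*m) := ⟨2*i.val+1, by have := i.isLt; omega⟩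

/-- `P` refines... rather: every block of `P` is contained in a block of `Q`
(the partial order on partitions by reverse refinement: `P ≤ Q`). -/
def Refines {α : Type*} (P Q : Set (Set α)) : Prop := ∀ B ∈ P, ∃ C ∈ Q, B ⊆ C

/-- The collection `p ∪ q̄` of subsets of the interleaved set
`1 < 1̄ < 2 < 2̄ < ... < m < m̄`, with `p` living on the unbarred copy and `q` on the
barred copy. -/
def interleave (m : ℕ) (p q : Set (Set (Fin m))) : Set (Set (Fin (2*m))) :=
  ((fun B => evens m '' B) '' p) ∪ ((fun B => odds m '' B) '' q)

/-- `q` is the Kreweras complement of `p`: `q` is the largest non-crossing partition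
(in the reverse-refinement order) such that `p ∪ q̄` is a non-crossing partition of the
interleaved set `1 < 1̄ < ... < m < m̄`. -/
def IsKr (m : ℕ) (p q : Set (Set (Fin m))) : Prop :=
  NCPart q ∧ NCPart (interleave m p q) ∧
  ∀ q', NCPart q' → NCPart (interleave m p q') → Refines q' q

/-- Two sets cross: there are `a < b < c < d` with `a, c ∈ B` and `b, d ∈ C`. -/
def Crossing {α : Type*} [LinearOrder α] (B C : Set α) : Prop :=
  ∃ a b c d : α, a < b ∧ b < c ∧ c < d ∧ a ∈ B ∧ c ∈ B ∧ b ∈ C ∧ d ∈ C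

/-- Two members of a non-crossing family of pairwise disjoint sets: disjoint,
and neither crosses the other. -/
def PairNC {α : Type*} [LinearOrder α] (B C : Set α) : Prop :=
  Disjoint B C ∧ ¬ Crossing B C ∧ ¬ Crossing C B

end NCPB
namespace NCPB

/-- The generating set `R_n` of the hyperoctahedral group: all transpositions `(i,-i)`
and all products `(i,j)(-i,-j)` with `|i| ≠ |j|`. -/
def Rn (n : ℕ) : Set (Equiv.Perm (Fin (2*n))) :=
  {ρ | (∃ i, ρ = Equiv.swap i (negMap n i)) ∨
       (∃ i j, absMap n i ≠ absMap n j ∧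
          ρ = Equiv.swap i j * Equiv.swap (negMap n i) (negMap n j))}

/-- Membership in the hyperoctahedral group `W_n`: permutations of `[±n]` commuting
with the inversion map. -/
def InWn (n : ℕ) (τ : Equiv.Perm (Fin (2*n))) : Prop :=
  ∀ k, τ (negMap n k) = negMap n (τ k)

/-- Word-length with respect to the generating set `R_n`. -/
noncomputable def lenB (n : ℕ) (τ : Equiv.Perm (Fin (2*n))) : ℕ :=
  sInf {k | ∃ l : List (Equiv.Perm (Fin (2*n))),
    (∀ ρ ∈ l, ρ ∈ Rn n) ∧ l.length = k ∧ l.prod = τ}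

/-- The partial order on `W_n` coming from `(W_n, R_n)`: `a ≤ b` iff `|a| + |a⁻¹b| = |b|`. -/
def leB (n : ℕ) (a b : Equiv.Perm (Fin (2*n))) : Prop :=
  lenB n a + lenB n (a⁻¹ * b) = lenB n b

/-- `b` covers `a` in the partial order coming from `(W_n, R_n)`. -/
def CoversB (n : ℕ) (a b : Equiv.Perm (Fin (2*n))) : Prop :=
  leB n a b ∧ lenB n b = lenB n a + 1

/-- The orbits of a permutation. -/
def orbitsOf (n : ℕ) (τ : Equiv.Perm (Fin (2*n))) : Set (Set (Fin (2*n))) :=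
  {O | ∃ x, O = {y | τ.SameCycle x y}}

/-- Word-length with respect to the set of all transpositions of a symmetric group. -/
noncomputable def lenA (N : ℕ) (τ : Equiv.Perm (Fin N)) : ℕ :=
  sInf {k | ∃ l : List (Equiv.Perm (Fin N)),
    (∀ ρ ∈ l, ρ.IsSwap) ∧ l.length = k ∧ l.prod = τ}

/-- The partial order on the symmetric group coming from all transpositions. -/
def leA (N : ℕ) (a b : Equiv.Perm (Fin N)) : Prop :=
  lenA N a + lenA N (a⁻¹ * b) = lenA N b

/-- `τ = ι(π)`: for each block `B` of `π` and `a ∈ B`, `τ a` is the cyclic successor of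
`a` in `B` (the least element of `B` greater than `a`, or the least element of `B` if
`a` is the largest element of `B`). -/
def IsIota (N : ℕ) (π : Set (Set (Fin N))) (τ : Equiv.Perm (Fin N)) : Prop :=
  ∀ B ∈ π, ∀ a ∈ B,
    ((∃ b ∈ B, a < b) → IsLeast {b | b ∈ B ∧ a < b} (τ a)) ∧
    ((∀ b ∈ B, ¬ a < b) → IsLeast B (τ a))

/-- The long inversion-invariant cycle `ω = (1, 2, ..., n, -1, -2, ..., -n)`. -/
def omegaW (n : ℕ) : Equiv.Perm (Fin (2*n)) := finRotate (2*n)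

end NCPB
namespace NCPB

variable {n : ℕ}

theorem negMap_val (x : Fin (2*n)) :
    (negMap n x).val = if x.val < n then x.val + n else x.val - n := by
  have := x.isLt
  simp only [negMap]
  split_ifs with h
  · exact Nat.mod_eq_of_lt (by omega)
  · rw [Nat.mod_eq_sub_mod (by omega), Nat.mod_eq_of_lt (by omega)]
    omega

@[simp] theorem negMap_negMap (x : Fin (2*n)) : negMap n (negMap n x) = x := by
  have := x.isLt
  ext
  rw [negMap_val, negMap_val]
  split_ifs <;> omega

theorem negMap_ne (x : Fin (2*n)) : negMap n x ≠ x := by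
  have := x.isLt
  rw [Ne, Fin.ext_iff, negMap_val]
  split_ifs <;> omega

theorem absMap_val (x : Fin (2*n)) :
    (absMap n x).val = if x.val < n then x.val else x.val - n := by
  have := x.isLt
  simp only [absMap]
  split_ifs with h
  · exact Nat.mod_eq_of_lt h
  · rw [Nat.mod_eq_sub_mod (by omega), Nat.mod_eq_of_lt (by omega)]

theorem absMap_eq_iff (x y : Fin (2*n)) : absMap n x = absMap n y ↔ x = y ∨ x = negMap n y := by
  have := x.isLt
  have := y.isLt
  rw [Fin.ext_iff, Fin.ext_iff, Fin.ext_iff, absMap_val, absMap_val, negMap_val]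
  split_ifs <;> omega

/-- The inversion map as a permutation. -/
def negPerm (n : ℕ) : Equiv.Perm (Fin (2*n)) :=
  ⟨negMap n, negMap n, negMap_negMap, negMap_negMap⟩

theorem inWn_iff_commute (w : Equiv.Perm (Fin (2*n))) : InWn n w ↔ Commute w (negPerm n) :=
  ⟨fun h => Equiv.ext h, fun h x => Equiv.congr_fun h x⟩

theorem InWn.one : InWn n 1 := fun _ => rfl

theorem InWn.mul {a b : Equiv.Perm (Fin (2*n))} (ha : InWn n a) (hb : InWn n b) :
    InWn n (a * b) := by
  rw [inWn_iff_commute] at *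
  exact ha.mul_left hb

theorem InWn.inv {a : Equiv.Perm (Fin (2*n))} (ha : InWn n a) : InWn n a⁻¹ := by
  rw [inWn_iff_commute] at *
  exact ha.inv_left

theorem InWn.sameCycle_negMap {w : Equiv.Perm (Fin (2*n))} (hw : InWn n w) {x y : Fin (2*n)}
    (h : w.SameCycle x y) : w.SameCycle (negMap n x) (negMap n y) := by
  have := h.conj (g := negPerm n)
  rwa [← ((inWn_iff_commute w).1 hw).eq, mul_inv_cancel_right] at this

theorem inWn_of_mem_Rn {r : Equiv.Perm (Fin (2*n))} (hr : r ∈ Rn n) : InWn n r := by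
  intro x
  obtain ⟨i, rfl⟩ | ⟨i, j, hij, rfl⟩ := hr
  · have h1 := negMap_negMap i
    have h2 := negMap_negMap x
    have := negMap_ne i
    simp only [Equiv.swap_apply_def]
    grind
  · rw [Ne, absMap_eq_iff] at hij
    have h1 := negMap_negMap i
    have h2 := negMap_negMap x
    have h3 := negMap_negMap j
    have := negMap_ne i
    have := negMap_ne j
    simp only [Equiv.Perm.mul_apply, Equiv.swap_apply_def]
    grind

theorem InWn.list_prod {l : List (Equiv.Perm (Fin (2*n)))} (h : ∀ r ∈ l, InWn n r) :
    InWn n l.prod := by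
  induction l with
  | nil => exact InWn.one
  | cons a l ih =>
    rw [List.prod_cons]
    exact (h a (by simp)).mul (ih fun r hr => h r (by simp [hr]))

/-- The `w`-invariant functions `f` on `[±n]` such that `f (-x) = c * f x` for all `x`. -/
def fixedFun (c : ℚ) (w : Equiv.Perm (Fin (2*n))) : Submodule ℚ (Fin (2*n) → ℚ) where
  carrier := {f | (∀ x, f (negMap n x) = c * f x) ∧ ∀ x, f (w x) = f x}
  add_mem' := by
    rintro f g ⟨h1, h2⟩ ⟨h3, h4⟩
    exact ⟨fun x => by simp [h1, h3, mul_add], fun x => by simp [h2, h4]⟩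
  zero_mem' := by simp
  smul_mem' := by
    rintro a f ⟨h1, h2⟩
    exact ⟨fun x => by simp [h1, mul_left_comm], fun x => by simp [h2]⟩

theorem mem_fixedFun {c : ℚ} {w : Equiv.Perm (Fin (2*n))} {f : Fin (2*n) → ℚ} :
    f ∈ fixedFun c w ↔ (∀ x, f (negMap n x) = c * f x) ∧ ∀ x, f (w x) = f x := Iff.rfl

theorem fixedFun_le_one (c : ℚ) (w : Equiv.Perm (Fin (2*n))) : fixedFun c w ≤ fixedFun c 1 :=
  fun _ hf => ⟨hf.1, fun _ => rfl⟩

theorem fixedFun_inf_le_mul (c : ℚ) (a b : Equiv.Perm (Fin (2*n))) :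
    fixedFun c a ⊓ fixedFun c b ≤ fixedFun c (a * b) :=
  fun _ hf => ⟨hf.1.1, fun x => (hf.1.2 (b x)).trans (hf.2.2 x)⟩

theorem finrank_fixedFun_add_le_inf (c : ℚ) (a b : Equiv.Perm (Fin (2*n))) :
    Module.finrank ℚ (fixedFun c a) + Module.finrank ℚ (fixedFun c b) ≤
      Module.finrank ℚ (fixedFun c (1 : Equiv.Perm (Fin (2*n)))) +
        Module.finrank ℚ ↥(fixedFun c a ⊓ fixedFun c b) := by
  rw [← Submodule.finrank_sup_add_finrank_inf_eq]
  have := Submodule.finrank_mono (sup_le (fixedFun_le_one c a) (fixedFun_le_one c b))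
  omega

theorem finrank_fixedFun_add_le_mul (c : ℚ) (a b : Equiv.Perm (Fin (2*n))) :
    Module.finrank ℚ (fixedFun c a) + Module.finrank ℚ (fixedFun c b) ≤
      Module.finrank ℚ (fixedFun c (1 : Equiv.Perm (Fin (2*n)))) +
        Module.finrank ℚ (fixedFun c (a * b)) := by
  have := finrank_fixedFun_add_le_inf c a b
  have := Submodule.finrank_mono (fixedFun_inf_le_mul c a b)
  omega

theorem finrank_fixedFun_one_le_of_functional {c : ℚ} {w : Equiv.Perm (Fin (2*n))}
    (φ : (Fin (2*n) → ℚ) →ₗ[ℚ] ℚ)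
    (h : ∀ f ∈ fixedFun c (1 : Equiv.Perm (Fin (2*n))), φ f = 0 → f ∈ fixedFun c w) :
    Module.finrank ℚ (fixedFun c (1 : Equiv.Perm (Fin (2*n)))) ≤
      Module.finrank ℚ (fixedFun c w) + 1 := by
  have h1 := Submodule.finrank_sup_add_finrank_inf_eq
    (fixedFun c (1 : Equiv.Perm (Fin (2*n)))) (LinearMap.ker φ)
  have h5 := Submodule.finrank_le (fixedFun c (1 : Equiv.Perm (Fin (2*n))) ⊔ LinearMap.ker φ)
  have h2 := Submodule.finrank_mono (s := fixedFun c 1 ⊓ LinearMap.ker φ) (t := fixedFun c w)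
    fun f hf => h f hf.1 hf.2
  have h3 := φ.finrank_range_add_finrank_ker
  have h4 := Submodule.finrank_le (LinearMap.range φ)
  rw [Module.finrank_self] at h4
  omega

theorem finrank_fixedFun_one_le_of_mem_Rn {r : Equiv.Perm (Fin (2*n))} (hr : r ∈ Rn n) :
    Module.finrank ℚ (fixedFun (-1) (1 : Equiv.Perm (Fin (2*n)))) ≤
      Module.finrank ℚ (fixedFun (-1) r) + 1 := by
  obtain ⟨i, rfl⟩ | ⟨i, j, hij, rfl⟩ := hr
  · refine finrank_fixedFun_one_le_of_functional (LinearMap.proj i) fun f hf h0 => ⟨hf.1, ?_⟩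
    intro x
    have := hf.1 i
    simp only [LinearMap.proj_apply] at h0
    rw [Equiv.swap_apply_def]
    grind
  · refine finrank_fixedFun_one_le_of_functional
      ((LinearMap.proj i : (Fin (2*n) → ℚ) →ₗ[ℚ] ℚ) - LinearMap.proj j)
      fun f hf h0 => ⟨hf.1, ?_⟩
    intro x
    have := hf.1 i
    have := hf.1 j
    simp only [LinearMap.sub_apply, LinearMap.proj_apply] at h0
    simp only [Equiv.Perm.mul_apply, Equiv.swap_apply_def]
    grind

theorem finrank_fixedFun_one_le_list_prod {l : List (Equiv.Perm (Fin (2*n)))}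
    (h : ∀ r ∈ l, r ∈ Rn n) :
    Module.finrank ℚ (fixedFun (-1) (1 : Equiv.Perm (Fin (2*n)))) ≤
      Module.finrank ℚ (fixedFun (-1) l.prod) + l.length := by
  induction l with
  | nil => exact le_rfl
  | cons a l ih =>
    have h1 := ih fun r hr => h r (by simp [hr])
    have h2 := finrank_fixedFun_one_le_of_mem_Rn (h a (by simp))
    have h3 := finrank_fixedFun_add_le_mul (-1) a l.prod
    rw [List.prod_cons, List.length_cons]
    omega

/-- The antisymmetrized indicator function of an orbit, `1_O - 1_{-O}`. -/
noncomputable def orbitFun (w : Equiv.Perm (Fin (2*n))) (z : Fin (2*n)) : Fin (2*n) → ℚ :=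
  fun x => (if w.SameCycle z x then 1 else 0) - (if w.SameCycle z (negMap n x) then 1 else 0)

theorem orbitFun_mem {w : Equiv.Perm (Fin (2*n))} (hw : InWn n w) (z : Fin (2*n)) :
    orbitFun w z ∈ fixedFun (-1) w := by
  refine ⟨fun x => ?_, fun x => ?_⟩
  · simp [orbitFun]
  · simp [orbitFun, ← hw x]

theorem fixedFun_le_of_eq {w v : Equiv.Perm (Fin (2*n))} (hw : InWn n w)
    (h : fixedFun (-1) w ≤ fixedFun (-1) v) {x : Fin (2*n)} (hx : w x = x) : v x = x := by
  have hs : ∀ y, w.SameCycle x y ↔ x = y := fun y => by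
    constructor
    · rintro ⟨i, hi⟩
      rw [← hi, Equiv.Perm.zpow_apply_eq_self_of_apply_eq_self hx]
    · rintro rfl
      rfl
  have h1 := (h (orbitFun_mem hw x)).2 x
  have h2 := negMap_ne x
  simp only [orbitFun, hs] at h1
  grind

theorem eq_one_of_finrank_eq {w : Equiv.Perm (Fin (2*n))}
    (h : Module.finrank ℚ (fixedFun (-1) (1 : Equiv.Perm (Fin (2*n)))) ≤
      Module.finrank ℚ (fixedFun (-1) w)) : w = 1 := by
  have := Submodule.eq_of_le_of_finrank_le (fixedFun_le_one _ _) h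
  ext1 x
  exact fixedFun_le_of_eq InWn.one this.ge rfl

theorem exists_mem_Rn_fixedFun_lt {w : Equiv.Perm (Fin (2*n))} (hw : InWn n w) (h1 : w ≠ 1) :
    ∃ r ∈ Rn n, r * r = 1 ∧ fixedFun (-1) w < fixedFun (-1) (r * w) := by
  obtain ⟨x, hx⟩ : ∃ x, w x ≠ x := by
    by_contra! h
    exact h1 (Equiv.ext h)
  suffices h : ∃ r ∈ Rn n, r * r = 1 ∧ r (w x) = x ∧ fixedFun (-1) w ≤ fixedFun (-1) r by
    obtain ⟨r, hr, hrr, hrx, hle⟩ := h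
    refine ⟨r, hr, hrr, lt_of_le_not_ge ?_ ?_⟩
    · exact (le_inf hle le_rfl).trans (fixedFun_inf_le_mul _ _ _)
    · intro h
      exact hx (fixedFun_le_of_eq ((inWn_of_mem_Rn hr).mul hw) h hrx)
  by_cases hn : w x = negMap n x
  · refine ⟨_, Or.inl ⟨x, rfl⟩, by simp, by simp [hn], fun f hf => ⟨hf.1, fun y => ?_⟩⟩
    have h2 := hf.1 x
    have h3 := hf.2 x
    rw [Equiv.swap_apply_def]
    grind
  · have hab : absMap n (w x) ≠ absMap n x := by simp [absMap_eq_iff, hx, hn]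
    have := negMap_ne x
    have := negMap_ne (w x)
    have := negMap_negMap x
    have := negMap_negMap (w x)
    refine ⟨_, Or.inr ⟨w x, x, hab, rfl⟩, ?_, ?_, fun f hf => ⟨hf.1, fun y => ?_⟩⟩
    · ext1 y
      simp only [Equiv.Perm.mul_apply, Equiv.swap_apply_def, Equiv.Perm.one_apply]
      grind
    · simp only [Equiv.Perm.mul_apply, Equiv.swap_apply_def]
      grind
    · have h2 := hf.1 x
      have h3 := hf.2 x
      have h4 := hf.1 (w x)
      simp only [Equiv.Perm.mul_apply, Equiv.swap_apply_def]
      grind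

theorem exists_list_of_inWn (m : ℕ) (w : Equiv.Perm (Fin (2*n))) (hw : InWn n w)
    (hm : Module.finrank ℚ (fixedFun (-1) (1 : Equiv.Perm (Fin (2*n)))) ≤
      Module.finrank ℚ (fixedFun (-1) w) + m) :
    ∃ l : List (Equiv.Perm (Fin (2*n))), (∀ r ∈ l, r ∈ Rn n) ∧ l.length ≤ m ∧ l.prod = w := by
  induction m generalizing w with
  | zero => exact ⟨[], by simp, by simp, (eq_one_of_finrank_eq hm).symm⟩
  | succ m ih =>
    by_cases h1 : w = 1
    · exact ⟨[], by simp, by simp, h1.symm⟩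
    obtain ⟨r, hr, hrr, hlt⟩ := exists_mem_Rn_fixedFun_lt hw h1
    have := Submodule.finrank_lt_finrank_of_lt hlt
    obtain ⟨l, hl, hlen, hprod⟩ := ih (r * w) ((inWn_of_mem_Rn hr).mul hw) (by omega)
    refine ⟨r :: l, by simpa [hr] using hl, by simpa using hlen, ?_⟩
    rw [List.prod_cons, hprod, ← mul_assoc, hrr, one_mul]

/-- The length of `w ∈ W_n` is the codimension of the space of odd `w`-invariant functions. -/
theorem lenB_add_finrank {w : Equiv.Perm (Fin (2*n))} (hw : InWn n w) :
    lenB n w + Module.finrank ℚ (fixedFun (-1) w) =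
      Module.finrank ℚ (fixedFun (-1) (1 : Equiv.Perm (Fin (2*n)))) := by
  have hle := Submodule.finrank_mono (fixedFun_le_one (-1) w)
  obtain ⟨l, hl, hlen, hprod⟩ := exists_list_of_inWn
    (Module.finrank ℚ (fixedFun (-1) (1 : Equiv.Perm (Fin (2*n)))) -
      Module.finrank ℚ (fixedFun (-1) w)) w hw (by omega)
  have h1 : lenB n w ≤ l.length := Nat.sInf_le ⟨l, hl, rfl, hprod⟩
  obtain ⟨l', hl', hlen', hprod'⟩ :
      lenB n w ∈ {k | ∃ l : List (Equiv.Perm (Fin (2*n))),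
        (∀ ρ ∈ l, ρ ∈ Rn n) ∧ l.length = k ∧ l.prod = w} := Nat.sInf_mem ⟨_, l, hl, rfl, hprod⟩
  have h2 := finrank_fixedFun_one_le_list_prod hl'
  rw [hprod'] at h2
  omega

theorem lenB_eq_zero_of_not_inWn {w : Equiv.Perm (Fin (2*n))} (hw : ¬ InWn n w) :
    lenB n w = 0 := by
  refine Nat.sInf_eq_zero.2 (Or.inr (Set.eq_empty_iff_forall_notMem.2 ?_))
  rintro k ⟨l, hl, -, rfl⟩
  exact hw (InWn.list_prod fun r hr => inWn_of_mem_Rn (hl r hr))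

theorem lenB_one : lenB n 1 = 0 := by
  have := lenB_add_finrank (InWn.one (n := n))
  omega

theorem leB_one (w : Equiv.Perm (Fin (2*n))) : leB n 1 w := by
  simp [leB, lenB_one]

theorem lenB_le_add {a b : Equiv.Perm (Fin (2*n))} (ha : InWn n a) (hb : InWn n b) :
    lenB n b ≤ lenB n a + lenB n (a⁻¹ * b) := by
  have h1 := lenB_add_finrank ha
  have h2 := lenB_add_finrank hb
  have h3 := lenB_add_finrank (ha.inv.mul hb)
  have h4 := finrank_fixedFun_add_le_mul (-1) a (a⁻¹ * b)
  rw [mul_inv_cancel_left] at h4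
  omega

theorem inWn_of_leB {a b : Equiv.Perm (Fin (2*n))} (hb : InWn n b) (hb1 : b ≠ 1)
    (h : leB n a b) : InWn n a := by
  by_contra ha
  have h2 : ¬ InWn n (a⁻¹ * b) := fun h => ha (by simpa using (h.mul hb.inv).inv)
  rw [leB, lenB_eq_zero_of_not_inWn ha, lenB_eq_zero_of_not_inWn h2] at h
  have := lenB_add_finrank hb
  exact hb1 (eq_one_of_finrank_eq (by omega))

theorem fixedFun_le_of_leB {a b : Equiv.Perm (Fin (2*n))} (ha : InWn n a) (hb : InWn n b)
    (h : leB n a b) : fixedFun (-1) b ≤ fixedFun (-1) a := by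
  have h1 := lenB_add_finrank ha
  have h2 := lenB_add_finrank hb
  have h3 := lenB_add_finrank (ha.inv.mul hb)
  have h4 := finrank_fixedFun_add_le_inf (-1) a (a⁻¹ * b)
  have h5 := fixedFun_inf_le_mul (-1) a (a⁻¹ * b)
  rw [mul_inv_cancel_left] at h5
  rw [leB] at h
  rw [← Submodule.eq_of_le_of_finrank_le h5 (by omega)]
  exact inf_le_left

theorem lenB_mul_of_disjoint {a b : Equiv.Perm (Fin (2*n))} (ha : InWn n a) (hb : InWn n b)
    (h : a.Disjoint b) : lenB n (a * b) = lenB n a + lenB n b := by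
  have h1 := lenB_add_finrank ha
  have h2 := lenB_add_finrank hb
  have h3 := lenB_add_finrank (ha.mul hb)
  have hfix : ∀ x, a x ≠ x → b x = x := fun x hx => (h x).resolve_left hx
  have hinf : fixedFun (-1) a ⊓ fixedFun (-1) b = fixedFun (-1) (a * b) := by
    refine le_antisymm (fixedFun_inf_le_mul _ _ _) fun f hf => ?_
    refine ⟨⟨hf.1, fun x => ?_⟩, ⟨hf.1, fun x => ?_⟩⟩
    · have := hf.2 x
      rw [Equiv.Perm.mul_apply] at this
      rcases h x with hx | hx
      · rw [hx]
      · rwa [hx] at this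
    · have := hf.2 x
      rw [Equiv.Perm.mul_apply] at this
      rcases h (b x) with hx | hx
      · rwa [hx] at this
      · rw [b.injective hx]
  have hsup : fixedFun (-1) a ⊔ fixedFun (-1) b = fixedFun (-1) (1 : Equiv.Perm (Fin (2*n))) := by
    refine le_antisymm (sup_le (fixedFun_le_one _ _) (fixedFun_le_one _ _)) fun f hf => ?_
    have hneg : ∀ x, a (negMap n x) = negMap n x ↔ a x = x := fun x => by
      rw [ha x]
      exact (negPerm n).injective.eq_iff
    have hax : ∀ x, a (a x) = a x ↔ a x = x := fun x => a.injective.eq_iff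
    have hbx : ∀ x, a (b x) = b x ↔ a x = x := fun x => by
      rcases h x with hx | hx
      · rw [← Equiv.Perm.mul_apply, h.commute.eq, Equiv.Perm.mul_apply, hx]
        simp
      · rw [hx]
    refine Submodule.mem_sup.2 ⟨fun x => if a x = x then f x else 0, ⟨fun x => ?_, fun x => ?_⟩,
      fun x => if a x = x then 0 else f x, ⟨fun x => ?_, fun x => ?_⟩, ?_⟩
    · simp only [hneg]
      split_ifs
      · exact hf.1 x
      · simp
    · simp only [hax]
      split_ifs with hx
      · rw [hx]
      · rfl
    · simp only [hneg]
      split_ifs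
      · simp
      · exact hf.1 x
    · simp only [hbx]
      split_ifs with hx
      · rfl
      · rw [hfix x hx]
    · ext x
      simp only [Pi.add_apply]
      split_ifs <;> simp
  have h4 := Submodule.finrank_sup_add_finrank_inf_eq (fixedFun (-1) a) (fixedFun (-1) b)
  rw [hinf, hsup] at h4
  omega

theorem lenB_list_prod {l : List (Equiv.Perm (Fin (2*n)))} (h : ∀ r ∈ l, InWn n r)
    (hd : l.Pairwise Equiv.Perm.Disjoint) : lenB n l.prod = (l.map (lenB n)).sum := by
  induction l with
  | nil => simp [lenB_one]
  | cons a l ih =>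
    rw [List.pairwise_cons] at hd
    have hl : ∀ r ∈ l, InWn n r := fun r hr => h r (by simp [hr])
    rw [List.prod_cons, lenB_mul_of_disjoint (h a (by simp)) (InWn.list_prod hl)
      (Equiv.Perm.disjoint_prod_right l hd.1), ih hl hd.2, List.map_cons, List.sum_cons]

theorem mul_mem_fixedFun_neg {c : ℚ} {w : Equiv.Perm (Fin (2*n))} {s f : Fin (2*n) → ℚ}
    (hs : s ∈ fixedFun (-1) w) (hf : f ∈ fixedFun c w) : s * f ∈ fixedFun (-c) w := by
  refine ⟨fun x => ?_, fun x => ?_⟩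
  · rw [Pi.mul_apply, Pi.mul_apply, hs.1, hf.1]
    ring
  · rw [Pi.mul_apply, Pi.mul_apply, hs.2, hf.2]

theorem finrank_fixedFun_le_neg {c : ℚ} {w : Equiv.Perm (Fin (2*n))} {s : Fin (2*n) → ℚ}
    (hs : s ∈ fixedFun (-1) w) (h : ∀ f ∈ fixedFun c w, ∀ x, s x = 0 → f x = 0) :
    Module.finrank ℚ (fixedFun c w) ≤ Module.finrank ℚ (fixedFun (-c) w) := by
  let L : fixedFun c w →ₗ[ℚ] fixedFun (-c) w :=
    { toFun := fun f => ⟨s * f.1, mul_mem_fixedFun_neg hs f.2⟩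
      map_add' := fun f g => by ext x; simp [mul_add]
      map_smul' := fun a f => by ext x; simp [mul_left_comm] }
  refine LinearMap.finrank_le_finrank_of_injective (f := L) ?_
  refine (injective_iff_map_eq_zero L).2 fun f hf => ?_
  ext x
  have hx : s x * f.1 x = 0 := congr_fun (congr_arg Subtype.val hf) x
  exact (mul_eq_zero.1 hx).elim (h f.1 f.2 x) id

theorem finrank_fixedFun_add_two_le_neg {c : ℚ} {w : Equiv.Perm (Fin (2*n))}
    {s u v : Fin (2*n) → ℚ} {y z : Fin (2*n)}
    (hs : s ∈ fixedFun (-1) w) (h : ∀ f ∈ fixedFun c w, ∀ x, s x = 0 → f x = 0)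
    (hu : u ∈ fixedFun (-c) w) (hv : v ∈ fixedFun (-c) w) (hsy : s y = 0) (hsz : s z = 0)
    (huy : u y = 1) (huz : u z = 0) (hvy : v y = 0) (hvz : v z = 1) :
    Module.finrank ℚ (fixedFun c w) + 2 ≤ Module.finrank ℚ (fixedFun (-c) w) := by
  let L : (fixedFun c w × ℚ × ℚ) →ₗ[ℚ] fixedFun (-c) w :=
    { toFun := fun p => ⟨s * p.1.1, mul_mem_fixedFun_neg hs p.1.2⟩ + p.2.1 • ⟨u, hu⟩ + p.2.2 • ⟨v, hv⟩
      map_add' := fun f g => by ext x; simp; ring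
      map_smul' := fun a f => by ext x; simp; ring }
  have h1 := LinearMap.finrank_le_finrank_of_injective (f := L) <| by
    refine (injective_iff_map_eq_zero L).2 ?_
    rintro ⟨f, a, b⟩ hf
    have hx : ∀ x, s x * f.1 x + a * u x + b * v x = 0 :=
      fun x => congr_fun (congr_arg Subtype.val hf) x
    have ha : a = 0 := by simpa [hsy, huy, hvy] using hx y
    have hb : b = 0 := by simpa [hsz, huz, hvz] using hx z
    subst ha hb
    have hf0 : f = 0 := by
      ext x
      have := hx x
      simp only [zero_mul, add_zero] at this
      exact (mul_eq_zero.1 this).elim (h f.1 f.2 x) id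
    rw [hf0]
    rfl
  simp only [Module.finrank_prod, Module.finrank_self] at h1
  omega

/-- There is an odd `w`-invariant function vanishing only on the orbits `Z = -Z`. -/
theorem exists_mem_fixedFun_eq_zero_iff {w : Equiv.Perm (Fin (2*n))} (hw : InWn n w) :
    ∃ s ∈ fixedFun (-1) w, ∀ x, s x = 0 ↔ w.SameCycle x (negMap n x) := by
  let g : Set (Fin (2*n)) → ℚ := fun X => (Fintype.equivFin (Set (Fin (2*n))) X : ℕ)
  have hg : Function.Injective g := fun X Y h =>
    (Fintype.equivFin _).injective (Fin.ext (Nat.cast_injective h))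
  refine ⟨fun x => g {y | w.SameCycle x y} - g {y | w.SameCycle (negMap n x) y},
    ⟨fun x => ?_, fun x => ?_⟩, fun x => ?_⟩
  · simp
  · simp [← hw x]
  · rw [sub_eq_zero, hg.eq_iff, Set.ext_iff]
    exact ⟨fun h => (h _).2 (Equiv.Perm.SameCycle.refl _ _),
      fun h y => ⟨fun h' => h.symm.trans h', fun h' => h.trans h'⟩⟩

theorem eq_zero_of_mem_fixedFun {w : Equiv.Perm (Fin (2*n))} {f : Fin (2*n) → ℚ}
    (hf : f ∈ fixedFun (-1) w) {x : Fin (2*n)} (hx : w.SameCycle x (negMap n x)) : f x = 0 := by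
  have h1 : ∀ i : ℤ, f ((w ^ i) x) = f x := fun i => by
    induction i with
    | zero => simp
    | succ i ih => rw [add_comm, zpow_add, zpow_one, Equiv.Perm.mul_apply, hf.2, ih]
    | pred i ih =>
      rw [← ih, ← hf.2, ← Equiv.Perm.mul_apply, ← zpow_one_add]
      congr 3
      ring
  obtain ⟨i, hi⟩ := hx
  have h2 := h1 i
  rw [hi, hf.1] at h2
  linarith

theorem finrank_fixedFun_neg_one_le_one {w : Equiv.Perm (Fin (2*n))} (hw : InWn n w) :
    Module.finrank ℚ (fixedFun (-1) w) ≤ Module.finrank ℚ (fixedFun 1 w) := by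
  obtain ⟨s, hs, h⟩ := exists_mem_fixedFun_eq_zero_iff hw
  have := finrank_fixedFun_le_neg (c := -1) hs
    fun f hf x hx => eq_zero_of_mem_fixedFun hf ((h x).1 hx)
  rwa [neg_neg] at this

theorem finrank_fixedFun_one_one_le :
    Module.finrank ℚ (fixedFun 1 (1 : Equiv.Perm (Fin (2*n)))) ≤
      Module.finrank ℚ (fixedFun (-1) (1 : Equiv.Perm (Fin (2*n)))) := by
  obtain ⟨s, hs, h⟩ := exists_mem_fixedFun_eq_zero_iff (InWn.one (n := n))
  refine finrank_fixedFun_le_neg hs fun f hf x hx => ?_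
  have := (h x).1 hx
  rw [Equiv.Perm.sameCycle_one] at this
  exact absurd this.symm (negMap_ne x)

theorem sameCycle_negMap_of_balanced {w : Equiv.Perm (Fin (2*n))} (hw : InWn n w)
    {y : Fin (2*n)} (hy : w.SameCycle y (negMap n y)) (x : Fin (2*n)) :
    w.SameCycle y (negMap n x) ↔ w.SameCycle y x := by
  refine ⟨fun h => ?_, fun h => hy.trans (hw.sameCycle_negMap h)⟩
  have := hy.trans (hw.sameCycle_negMap h)
  rwa [negMap_negMap] at this

theorem orbit_indicator_mem {w : Equiv.Perm (Fin (2*n))} (hw : InWn n w)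
    {y : Fin (2*n)} (hy : w.SameCycle y (negMap n y)) :
    (fun x => if w.SameCycle y x then 1 else 0) ∈ fixedFun 1 w :=
  ⟨fun x => by simp [sameCycle_negMap_of_balanced hw hy], fun x => by simp⟩

theorem finrank_fixedFun_add_two_le {w : Equiv.Perm (Fin (2*n))} (hw : InWn n w)
    {y z : Fin (2*n)} (hy : w.SameCycle y (negMap n y)) (hz : w.SameCycle z (negMap n z))
    (hyz : ¬ w.SameCycle y z) :
    Module.finrank ℚ (fixedFun (-1) w) + 2 ≤ Module.finrank ℚ (fixedFun 1 w) := by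
  obtain ⟨s, hs, h⟩ := exists_mem_fixedFun_eq_zero_iff hw
  have := finrank_fixedFun_add_two_le_neg (c := -1) hs
    (fun f hf x hx => eq_zero_of_mem_fixedFun hf ((h x).1 hx))
    (by rw [neg_neg]; exact orbit_indicator_mem hw hy)
    (by rw [neg_neg]; exact orbit_indicator_mem hw hz) ((h y).2 hy) ((h z).2 hz)
    (by simp [Equiv.Perm.SameCycle.refl]) (by simp [hyz])
    (by simp [Equiv.Perm.sameCycle_comm (x := z), hyz]) (by simp [Equiv.Perm.SameCycle.refl])
  rwa [neg_neg] at this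

theorem omegaW_val (x : Fin (2*n)) :
    (omegaW n x).val = if x.val + 1 < 2*n then x.val + 1 else 0 := by
  have hx := x.isLt
  unfold omegaW
  generalize 2 * n = m at *
  obtain _ | m := m
  · omega
  · split_ifs with h
    · exact coe_finRotate_of_ne_last (by rw [Ne, Fin.ext_iff, Fin.val_last]; omega)
    · rw [show x = Fin.last m from Fin.ext (by rw [Fin.val_last]; omega), finRotate_last]
      rfl

theorem omegaW_inWn : InWn n (omegaW n) := by
  intro x
  have := x.isLt
  ext
  simp only [omegaW_val, negMap_val]
  split_ifs <;> omega

theorem eq_of_mem_fixedFun_omegaW {c : ℚ} {f : Fin (2*n) → ℚ} (hf : f ∈ fixedFun c (omegaW n))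
    (x y : Fin (2*n)) : f x = f y := by
  have h : ∀ m (hm : m < 2*n), f ⟨m, hm⟩ = f ⟨0, by omega⟩ := by
    intro m
    induction m with
    | zero => exact fun _ => rfl
    | succ m ih =>
      intro hm
      rw [← ih (by omega), ← hf.2 ⟨m, by omega⟩]
      congr 1
      ext
      rw [omegaW_val]
      simp [hm]
  exact (h x.1 x.2).trans (h y.1 y.2).symm

theorem finrank_fixedFun_neg_one_omegaW :
    Module.finrank ℚ (fixedFun (-1) (omegaW n)) = 0 := by
  rw [Submodule.finrank_eq_zero, eq_bot_iff]
  intro f hf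
  rw [Submodule.mem_bot]
  ext x
  have h1 := hf.1 x
  rw [eq_of_mem_fixedFun_omegaW hf (negMap n x) x] at h1
  simp only [Pi.zero_apply]
  linarith

theorem finrank_fixedFun_one_omegaW : Module.finrank ℚ (fixedFun 1 (omegaW n)) ≤ 1 := by
  refine (Submodule.finrank_mono (t := Submodule.span ℚ {fun _ => (1 : ℚ)}) fun f hf => ?_).trans
    (by simpa using finrank_span_le_card (R := ℚ) {fun _ : Fin (2*n) => (1 : ℚ)})
  rw [Submodule.mem_span_singleton]
  rcases isEmpty_or_nonempty (Fin (2*n)) with h | ⟨⟨x⟩⟩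
  · exact ⟨0, Subsingleton.elim _ _⟩
  · exact ⟨f x, by ext y; simpa using eq_of_mem_fixedFun_omegaW hf x y⟩

/-- An element of `[ε, ω]` has at most one orbit `Z` with `Z = -Z`. -/
theorem sameCycle_of_balanced_of_leB_omegaW {w : Equiv.Perm (Fin (2*n))} (hw : InWn n w)
    (hle : leB n w (omegaW n)) {y z : Fin (2*n)}
    (hy : w.SameCycle y (negMap n y)) (hz : w.SameCycle z (negMap n z)) : w.SameCycle y z := by
  by_contra hyz
  have hv := hw.inv.mul omegaW_inWn
  have h1 := finrank_fixedFun_add_two_le hw hy hz hyz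
  have h2 := finrank_fixedFun_neg_one_le_one hv
  have h3 := finrank_fixedFun_add_le_mul 1 w (w⁻¹ * omegaW n)
  rw [mul_inv_cancel_left] at h3
  have h4 := finrank_fixedFun_one_omegaW (n := n)
  have h5 := finrank_fixedFun_neg_one_omegaW (n := n)
  have h6 := finrank_fixedFun_one_one_le (n := n)
  have h7 := lenB_add_finrank hw
  have h8 := lenB_add_finrank hv
  have h9 := lenB_add_finrank (omegaW_inWn (n := n))
  rw [leB] at hle
  omega

theorem sameCycle_or_of_not_balanced {w v : Equiv.Perm (Fin (2*n))} (hw : InWn n w)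
    (h : fixedFun (-1) w ≤ fixedFun (-1) v) {y z : Fin (2*n)}
    (hz : ¬ w.SameCycle z (negMap n z)) (hyz : ∀ f ∈ fixedFun (-1) v, f y = f z) :
    w.SameCycle z y ∨ w.SameCycle z (negMap n y) := by
  have h1 := hyz _ (h (orbitFun_mem hw z))
  by_contra! hc
  simp [orbitFun, hc, hz, Equiv.Perm.SameCycle.refl] at h1

theorem sameCycle_apply_or {τ σ : Equiv.Perm (Fin (2*n))} (hτ : InWn n τ) (hσ : InWn n σ)
    (hτω : leB n τ (omegaW n)) (hle : leB n σ τ) (y : Fin (2*n)) :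
    τ.SameCycle y (σ y) ∨ τ.SameCycle y (negMap n (σ y)) := by
  have h := fixedFun_le_of_leB hσ hτ hle
  by_cases hy : τ.SameCycle y (negMap n y)
  · by_cases hz : τ.SameCycle (σ y) (negMap n (σ y))
    · exact Or.inl (sameCycle_of_balanced_of_leB_omegaW hτ hτω hy hz)
    · rcases sameCycle_or_of_not_balanced hτ h hz (fun f hf => (hf.2 y).symm) with h' | h'
      · exact Or.inl h'.symm
      · have := (hτ.sameCycle_negMap h').symm
        rw [negMap_negMap] at this
        exact Or.inr this
  · exact sameCycle_or_of_not_balanced hτ h hy (fun f hf => hf.2 y)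

theorem apply_mem_of_fix_off {α : Type*} {σ : Equiv.Perm α} {Y : Set α}
    (h : ∀ x, x ∉ Y → σ x = x) {x : α} (hx : x ∈ Y) : σ x ∈ Y := by
  by_contra hc
  exact hc (by rwa [σ.injective (h _ hc)])

theorem list_ofFn_prod_apply {α : Type*} {k : ℕ} {Ys : Fin k → Set α}
    (hdisj : ∀ j₁ j₂, j₁ ≠ j₂ → Disjoint (Ys j₁) (Ys j₂)) {σs : Fin k → Equiv.Perm α}
    (h : ∀ j x, x ∉ Ys j → σs j x = x) (x : α) :
    (∀ j, x ∈ Ys j → (List.ofFn σs).prod x = σs j x) ∧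
      ((∀ j, x ∉ Ys j) → (List.ofFn σs).prod x = x) := by
  induction k with
  | zero => simp
  | succ k ih =>
    have hd : ∀ {i j x}, i ≠ j → x ∈ Ys i → x ∉ Ys j :=
      fun hij hx => Set.disjoint_left.1 (hdisj _ _ hij) hx
    obtain ⟨h1, h2⟩ := ih (Ys := fun j => Ys j.succ)
      (fun i j hij => hdisj _ _ (by simpa using hij)) (σs := fun j => σs j.succ)
      (fun j x hx => h j.succ x hx)
    rw [List.ofFn_succ, List.prod_cons]
    refine ⟨fun j => ?_, fun hx => ?_⟩
    · refine Fin.cases (fun hx => ?_) (fun i hx => ?_) j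
      · rw [Equiv.Perm.mul_apply, h2 fun i => hd (Fin.succ_ne_zero i).symm hx]
      · rw [Equiv.Perm.mul_apply, h1 i hx]
        exact h 0 _ (hd (Fin.succ_ne_zero i) (apply_mem_of_fix_off (h i.succ) hx))
    · rw [Equiv.Perm.mul_apply, h2 fun i => hx i.succ, h 0 _ (hx 0)]

theorem disjoint_of_fix_off {α : Type*} {a b : Equiv.Perm α} {Y Z : Set α} (hYZ : Disjoint Y Z)
    (ha : ∀ x, x ∉ Y → a x = x) (hb : ∀ x, x ∉ Z → b x = x) : a.Disjoint b := by
  intro x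
  by_cases hx : x ∈ Y
  · exact Or.inr (hb x (Set.disjoint_left.1 hYZ hx))
  · exact Or.inl (ha x hx)

theorem lenB_list_ofFn_prod {k : ℕ} {Ys : Fin k → Set (Fin (2*n))}
    (hdisj : ∀ j₁ j₂, j₁ ≠ j₂ → Disjoint (Ys j₁) (Ys j₂))
    {a : Fin k → Equiv.Perm (Fin (2*n))} (ha : ∀ j, InWn n (a j))
    (h : ∀ j x, x ∉ Ys j → a j x = x) :
    lenB n (List.ofFn a).prod = ∑ j, lenB n (a j) := by
  rw [lenB_list_prod, List.map_ofFn, List.sum_ofFn]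
  · rfl
  · simpa using ha
  · rw [List.pairwise_ofFn]
    exact fun i j hij => disjoint_of_fix_off (hdisj i j hij.ne) (h i) (h j)

theorem leB_list_ofFn_prod_iff {k : ℕ} {Ys : Fin k → Set (Fin (2*n))}
    (hdisj : ∀ j₁ j₂, j₁ ≠ j₂ → Disjoint (Ys j₁) (Ys j₂))
    {a b : Fin k → Equiv.Perm (Fin (2*n))} (ha : ∀ j, InWn n (a j))
    (hb : ∀ j, InWn n (b j)) (ha' : ∀ j x, x ∉ Ys j → a j x = x)
    (hb' : ∀ j x, x ∉ Ys j → b j x = x) :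
    leB n (List.ofFn a).prod (List.ofFn b).prod ↔ ∀ j, leB n (a j) (b j) := by
  have hc' : ∀ j x, x ∉ Ys j → (a j)⁻¹ (b j x) = x := fun j x hx => by
    rw [hb' j x hx, Equiv.Perm.inv_eq_iff_eq, ha' j x hx]
  have hprod : (List.ofFn a).prod⁻¹ * (List.ofFn b).prod =
      (List.ofFn fun j => (a j)⁻¹ * b j).prod := by
    rw [inv_mul_eq_iff_eq_mul]
    ext1 x
    rw [Equiv.Perm.mul_apply]
    by_cases hx : ∃ j, x ∈ Ys j
    · obtain ⟨j, hj⟩ := hx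
      rw [(list_ofFn_prod_apply hdisj hb' x).1 j hj,
        (list_ofFn_prod_apply hdisj (σs := fun j => (a j)⁻¹ * b j) hc' x).1 j hj,
        (list_ofFn_prod_apply hdisj ha' _).1 j
          (apply_mem_of_fix_off (σ := (a j)⁻¹ * b j) (hc' j) hj)]
      simp
    · push Not at hx
      rw [(list_ofFn_prod_apply hdisj hb' x).2 hx,
        (list_ofFn_prod_apply hdisj (σs := fun j => (a j)⁻¹ * b j) hc' x).2 hx,
        (list_ofFn_prod_apply hdisj ha' x).2 hx]
  rw [leB, hprod, lenB_list_ofFn_prod hdisj ha ha', lenB_list_ofFn_prod hdisj hb hb',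
    lenB_list_ofFn_prod hdisj (fun j => (ha j).inv.mul (hb j)) hc', ← Finset.sum_add_distrib,
    eq_comm, Finset.sum_eq_sum_iff_of_le fun j _ => lenB_le_add (ha j) (hb j)]
  simp [leB, eq_comm]

end NCPB

open NCPB in
/-- Let `τ ∈ [ε, ω]`, `τ ≠ ε`, with cycle factorization of type B
`τ = τ₁ ⋯ τ_k` (the `τ_j` act like `τ` on the sets `Y_j = X ∪ (-X)`, `X` an orbit of
`τ` with more than one element, and trivially elsewhere).  Then products of elements
`σ_j ∈ [ε, τ_j]` commute and lie in `[ε, τ]`; every `σ ∈ [ε, τ]` factors uniquely this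
way; and the factorization gives a poset isomorphism `[ε, τ] ≅ [ε, τ₁] × ⋯ × [ε, τ_k]`. -/
theorem cycle_factorization_typeB_interval (n : ℕ) (hn : 0 < n)
    (τ : Equiv.Perm (Fin (2*n))) (hW : InWn n τ)
    (hτω : leB n τ (omegaW n)) (hτne : τ ≠ 1)
    (k : ℕ) (τs : Fin k → Equiv.Perm (Fin (2*n))) (Ys : Fin k → Set (Fin (2*n)))
    (hY : ∀ j, ∃ x, τ x ≠ x ∧
        Ys j = {y | τ.SameCycle x y} ∪ negSet n {y | τ.SameCycle x y})
    (hdisj : ∀ j₁ j₂, j₁ ≠ j₂ → Disjoint (Ys j₁) (Ys j₂))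
    (hcover : ∀ x, τ x ≠ x → ∃ j, x ∈ Ys j)
    (hact : ∀ j x, (x ∈ Ys j → τs j x = τ x) ∧ (x ∉ Ys j → τs j x = x)) :
    (∀ σs : Fin k → Equiv.Perm (Fin (2*n)),
        (∀ j, leB n 1 (σs j) ∧ leB n (σs j) (τs j)) →
        ((∀ j₁ j₂, Commute (σs j₁) (σs j₂)) ∧
         leB n 1 (List.ofFn σs).prod ∧ leB n (List.ofFn σs).prod τ)) ∧
    (∀ σ : Equiv.Perm (Fin (2*n)), leB n 1 σ → leB n σ τ →
        ∃! σs : Fin k → Equiv.Perm (Fin (2*n)),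
          (∀ j, leB n 1 (σs j) ∧ leB n (σs j) (τs j)) ∧ σ = (List.ofFn σs).prod) ∧
    (∀ σs σs' : Fin k → Equiv.Perm (Fin (2*n)),
        (∀ j, leB n 1 (σs j) ∧ leB n (σs j) (τs j)) →
        (∀ j, leB n 1 (σs' j) ∧ leB n (σs' j) (τs j)) →
        (leB n (List.ofFn σs).prod (List.ofFn σs').prod ↔ ∀ j, leB n (σs j) (σs' j))) := by
  have hmem : ∀ j x y, x ∈ Ys j → τ.SameCycle x y ∨ τ.SameCycle x (negMap n y) → y ∈ Ys j := by
    intro j x y hx hxy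
    obtain ⟨z, -, hz⟩ := hY j
    have hYj : ∀ u, u ∈ Ys j ↔ τ.SameCycle z u ∨ τ.SameCycle z (negMap n u) := fun u => by
      rw [hz, Set.mem_union, negSet, Set.mem_ofPred_eq]
      refine or_congr Iff.rfl ⟨?_, fun h => ⟨_, h, negMap_negMap u⟩⟩
      rintro ⟨v, hv, rfl⟩
      rwa [negMap_negMap]
    rw [hYj] at hx ⊢
    have hneg : ∀ {u v}, τ.SameCycle u (negMap n v) → τ.SameCycle (negMap n u) v := fun h => by
      simpa using hW.sameCycle_negMap h
    rcases hx with hx | hx <;> rcases hxy with h | h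
    · exact Or.inl (hx.trans h)
    · exact Or.inr (hx.trans h)
    · exact Or.inr (hx.trans (hW.sameCycle_negMap h))
    · exact Or.inl (hx.trans (hneg h))
  have hnegY : ∀ j x, negMap n x ∈ Ys j ↔ x ∈ Ys j := fun j x =>
    ⟨fun h => hmem j _ _ h (Or.inr (Equiv.Perm.SameCycle.refl _ _)),
      fun h => hmem j _ _ h (Or.inr (by rw [negMap_negMap]))⟩
  have hτsW : ∀ j, InWn n (τs j) := fun j x => by
    by_cases hx : x ∈ Ys j
    · rw [(hact j x).1 hx, (hact j _).1 ((hnegY j x).2 hx), hW]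
    · rw [(hact j x).2 hx, (hact j _).2 (mt (hnegY j x).1 hx)]
  have hτsne : ∀ j, τs j ≠ 1 := fun j h => by
    obtain ⟨z, hz, hz'⟩ := hY j
    have hzY : z ∈ Ys j := by
      rw [hz']
      exact Or.inl (Equiv.Perm.SameCycle.refl _ _)
    rw [← (hact j z).1 hzY, h] at hz
    exact hz rfl
  have hτoff : ∀ j x, x ∉ Ys j → τs j x = x := fun j x => (hact j x).2
  have hprodτ : (List.ofFn τs).prod = τ := by
    ext1 x
    by_cases hx : ∃ j, x ∈ Ys j
    · obtain ⟨j, hj⟩ := hx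
      rw [(list_ofFn_prod_apply hdisj hτoff x).1 j hj, (hact j x).1 hj]
    · rw [(list_ofFn_prod_apply hdisj hτoff x).2 (by simpa using hx)]
      exact (not_not.1 (mt (hcover x) hx)).symm
  have hσ : ∀ {σs : Fin k → Equiv.Perm (Fin (2*n))},
      (∀ j, leB n 1 (σs j) ∧ leB n (σs j) (τs j)) →
        (∀ j, InWn n (σs j)) ∧ ∀ j x, x ∉ Ys j → σs j x = x := by
    intro σs h
    have hw : ∀ j, InWn n (σs j) := fun j => inWn_of_leB (hτsW j) (hτsne j) (h j).2
    exact ⟨hw, fun j x hx => fixedFun_le_of_eq (hτsW j)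
      (fixedFun_le_of_leB (hw j) (hτsW j) (h j).2) (hτoff j x hx)⟩
  refine ⟨fun σs h => ?_, fun σ _ hle => ?_, fun σs σs' h h' => ?_⟩
  · obtain ⟨hw, hoff⟩ := hσ h
    refine ⟨fun i j => ?_, leB_one _, ?_⟩
    · rcases eq_or_ne i j with rfl | hij
      · exact Commute.refl _
      · exact (disjoint_of_fix_off (hdisj i j hij) (hoff i) (hoff j)).commute
    · rw [← hprodτ, leB_list_ofFn_prod_iff hdisj hw hτsW hoff hτoff]
      exact fun j => (h j).2
  · have hσW := inWn_of_leB hW hτne hle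
    have hσY : ∀ j x, σ x ∈ Ys j ↔ x ∈ Ys j := fun j x => by
      have hxσ := sameCycle_apply_or hW hσW hτω hle x
      refine ⟨fun h => hmem j _ _ h ?_, fun h => hmem j _ _ h hxσ⟩
      refine hxσ.imp (fun h => h.symm) fun h => ?_
      simpa using (hW.sameCycle_negMap h).symm
    let σs : Fin k → Equiv.Perm (Fin (2*n)) := fun j =>
      Equiv.Perm.ofSubtype (σ.subtypePerm (p := fun x => x ∈ Ys j) (hσY j))
    have hon : ∀ j x, x ∈ Ys j → σs j x = σ x := fun j x hx =>
      Equiv.Perm.ofSubtype_apply_of_mem _ hx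
    have hoff : ∀ j x, x ∉ Ys j → σs j x = x := fun j x hx =>
      Equiv.Perm.ofSubtype_apply_of_not_mem _ hx
    have hsW : ∀ j, InWn n (σs j) := fun j x => by
      by_cases hx : x ∈ Ys j
      · rw [hon j x hx, hon j _ ((hnegY j x).2 hx), hσW]
      · rw [hoff j x hx, hoff j _ (mt (hnegY j x).1 hx)]
    have hprod : σ = (List.ofFn σs).prod := by
      ext1 x
      by_cases hx : ∃ j, x ∈ Ys j
      · obtain ⟨j, hj⟩ := hx
        rw [(list_ofFn_prod_apply hdisj hoff x).1 j hj, hon j x hj]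
      · rw [(list_ofFn_prod_apply hdisj hoff x).2 (by simpa using hx)]
        exact fixedFun_le_of_eq hW (fixedFun_le_of_leB hσW hW hle) (not_not.1 (mt (hcover x) hx))
    refine ⟨σs, ⟨fun j => ⟨leB_one _, ?_⟩, hprod⟩, fun ρs hρ => ?_⟩
    · rw [hprod, ← hprodτ, leB_list_ofFn_prod_iff hdisj hsW hτsW hoff hτoff] at hle
      exact hle j
    · obtain ⟨-, hρoff⟩ := hσ hρ.1
      ext1 j
      ext1 x
      by_cases hx : x ∈ Ys j
      · rw [hon j x hx, hρ.2, (list_ofFn_prod_apply hdisj hρoff x).1 j hx]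
      · rw [hoff j x hx, hρoff j x hx]
  · obtain ⟨hw, hoff⟩ := hσ h
    obtain ⟨hw', hoff'⟩ := hσ h'
    exact leB_list_ofFn_prod_iff hdisj hw hw' hoff hoff'
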